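/- If a complete first-order theory T does not have the order property, then T is stable in every infinite cardinal λ satisfying λ^{|T|} = λ: for every parameter set of cardinality λ, there are at most λ complete types over it. -/

import Mathlib

open FirstOrder Cardinal

universe u v

variable {L : FirstOrder.Language.{u, u}} {M : Type u} [L.Structure M]

/-- Two tuples have the same type over a parameter set `A` (in the ambient structure `M`,
thought of as a monster model): they satisfy the same formulas with parameters from `A`. -/
def SameTypeOver (L : FirstOrder.Language.{u, u}) {M : Type u} [L.Structure M] (A : Set M) {α : Type v} (a b : α → M) : Prop :=
  ∀ (n : ℕ) (φ : L.Formula (α ⊕ Fin n)) (c : Fin n → M), (∀ i, c i ∈ A) →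
    (φ.Realize (Sum.elim a c) ↔ φ.Realize (Sum.elim b c))

/-- `a ⫝_N B` : the type `tp(a / N ∪ B)` is finitely satisfiable in `N`: every formula with
parameters from `N ∪ B` satisfied by `a` is satisfied by a tuple from `N`. -/
def FinSatIndep (L : FirstOrder.Language.{u, u}) {M : Type u} [L.Structure M] (N : Set M) {α : Type v} (a : α → M) (B : Set M) : Prop :=
  ∀ (n : ℕ) (φ : L.Formula (α ⊕ Fin n)) (c : Fin n → M), (∀ i, c i ∈ N ∪ B) →
    φ.Realize (Sum.elim a c) →
      ∃ a' : α → M, (∀ i, a' i ∈ N) ∧ φ.Realize (Sum.elim a' c)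

/-- The structure `M` has the order property: some formula orders an infinite sequence
of finite tuples. -/
def HasOrderProp (L : FirstOrder.Language.{u, u}) (M : Type u) [L.Structure M] : Prop :=
  ∃ (k : ℕ) (φ : L.Formula (Fin k ⊕ Fin k)) (a : ℕ → Fin k → M),
    ∀ i j : ℕ, φ.Realize (Sum.elim (a i) (a j)) ↔ i < j

/-- An abstract complete type over `B ⊆ M` in variables `α`, represented as a set of
formula/parameter pairs: parameters come from `B`, every finite subset is realized in `M`
(equivalently, the type is consistent with the elementary diagram of `M`), and the set is
complete (contains each formula over `B` or its negation). -/
def IsCompleteTypeOn (α : Type v) (B : Set M)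
    (p : Set (Σ n : ℕ, L.Formula (α ⊕ Fin n) × (Fin n → M))) : Prop :=
  (∀ q ∈ p, ∀ i, q.2.2 i ∈ B) ∧
  (∀ s : Finset (Σ n : ℕ, L.Formula (α ⊕ Fin n) × (Fin n → M)), ↑s ⊆ p →
    ∃ a : α → M, ∀ q ∈ s, q.2.1.Realize (Sum.elim a q.2.2)) ∧
  (∀ (n : ℕ) (φ : L.Formula (α ⊕ Fin n)) (c : Fin n → M), (∀ i, c i ∈ B) →
    (⟨n, (φ, c)⟩ ∈ p ∨ ⟨n, (φ.not, c)⟩ ∈ p))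

/-- The order property may be witnessed on tuples indexed by any finite type. -/
theorem hasOrderProp_of_finite {α : Type} [Finite α] (φ : L.Formula (α ⊕ α)) (a : ℕ → α → M)
    (h : ∀ i j : ℕ, φ.Realize (Sum.elim (a i) (a j)) ↔ i < j) : HasOrderProp L M := by
  obtain ⟨k, ⟨e⟩⟩ := Finite.exists_equiv_fin α
  refine ⟨k, φ.relabel (Sum.map e e), fun i => a i ∘ e.symm, fun i j => ?_⟩
  rw [FirstOrder.Language.Formula.realize_relabel, ← h i j]
  have : Sum.elim (a i ∘ e.symm) (a j ∘ e.symm) ∘ Sum.map e e = Sum.elim (a i) (a j) := by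
    ext x
    rcases x with x | x <;> simp
  rw [this]

/-- If `φ(a i, b j) ↔ φ(a i, c j)` holds exactly when `i < j`, then `M` has the order property. -/
theorem hasOrderProp_of_realize_iff {α β : Type} [Finite α] [Finite β] (φ : L.Formula (α ⊕ β))
    (a : ℕ → α → M) (b c : ℕ → β → M)
    (h : ∀ i j : ℕ, (φ.Realize (Sum.elim (a i) (b j)) ↔ φ.Realize (Sum.elim (a i) (c j))) ↔
      i < j) : HasOrderProp L M := by
  let f : α ⊕ β → (α ⊕ β ⊕ β) ⊕ (α ⊕ β ⊕ β) :=
    Sum.elim (fun x => .inl (.inl x)) (fun y => .inr (.inr (.inl y)))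
  let g : α ⊕ β → (α ⊕ β ⊕ β) ⊕ (α ⊕ β ⊕ β) :=
    Sum.elim (fun x => .inl (.inl x)) (fun y => .inr (.inr (.inr y)))
  refine hasOrderProp_of_finite ((φ.relabel f).iff (φ.relabel g))
    (fun i => Sum.elim (a i) (Sum.elim (b i) (c i))) fun i j => ?_
  rw [FirstOrder.Language.Formula.realize_iff, FirstOrder.Language.Formula.realize_relabel,
    FirstOrder.Language.Formula.realize_relabel, ← h i j]
  have hf : Sum.elim (Sum.elim (a i) (Sum.elim (b i) (c i)))
      (Sum.elim (a j) (Sum.elim (b j) (c j))) ∘ f = Sum.elim (a i) (b j) := by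
    ext x
    rcases x with x | x <;> rfl
  have hg : Sum.elim (Sum.elim (a i) (Sum.elim (b i) (c i)))
      (Sum.elim (a j) (Sum.elim (b j) (c j))) ∘ g = Sum.elim (a i) (c j) := by
    ext x
    rcases x with x | x <;> rfl
  rw [hf, hg]

/-- Without the order property, a set `p` of parameter tuples which is finitely approximated by
the sets `φ(r x, M)` is determined by the `φ`-traces on a finite subset of the index type. -/
theorem exists_finset_trace_determines {α β : Type} [Finite α] [Finite β]
    (hNOP : ¬ HasOrderProp L M) (φ : L.Formula (α ⊕ β)) {ι B : Type*} (r : ι → α → M)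
    (v : B → β → M) (p : Set B)
    (hp : ∀ s t : Finset B, (∀ b ∈ s, b ∈ p) → (∀ c ∈ t, c ∉ p) → ∃ x : ι,
      (∀ b ∈ s, φ.Realize (Sum.elim (r x) (v b))) ∧
      ∀ c ∈ t, ¬ φ.Realize (Sum.elim (r x) (v c))) :
    ∃ s : Finset ι, ∀ b c : B, (∀ x ∈ s, φ.Realize (Sum.elim (r x) (v b)) ↔
      φ.Realize (Sum.elim (r x) (v c))) → b ∈ p → c ∈ p := by
  classical
  by_contra! hcon
  choose b c hbc hb hc using hcon
  have hg : ∀ s : Finset ι, ∃ x : ι, ∀ t ⊆ s, φ.Realize (Sum.elim (r x) (v (b t))) ∧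
      ¬ φ.Realize (Sum.elim (r x) (v (c t))) := by
    intro s
    obtain ⟨x, hx, hx'⟩ := hp (s.powerset.image b) (s.powerset.image c)
      (by simp [hb]) (by simp [hc])
    exact ⟨x, fun t ht => ⟨hx _ (Finset.mem_image_of_mem b (Finset.mem_powerset.2 ht)),
      hx' _ (Finset.mem_image_of_mem c (Finset.mem_powerset.2 ht))⟩⟩
  choose g hg using hg
  let S : ℕ → Finset ι := fun n => Nat.rec ∅ (fun _ s => insert (g s) s) n
  have hS : ∀ n, S (n + 1) = insert (g (S n)) (S n) := fun _ => rfl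
  have hmono : Monotone S := monotone_nat_of_le_succ fun n => by
    rw [hS]
    exact Finset.subset_insert _ _
  refine hNOP (hasOrderProp_of_realize_iff φ (fun n => r (g (S n))) (fun n => v (b (S n)))
    (fun n => v (c (S n))) fun i j => ⟨fun h => ?_, fun hij => ?_⟩)
  · by_contra hij
    obtain ⟨h₁, h₂⟩ := hg (S i) (S j) (hmono (not_lt.1 hij))
    exact h₂ (h.1 h₁)
  · refine hbc (S j) _ (hmono (Nat.succ_le_of_lt hij) ?_)
    rw [hS]
    exact Finset.mem_insert_self _ _

theorem mk_finset_le {α : Type u} {lam : Cardinal.{u}} (hlam : ℵ₀ ≤ lam) (h : #α ≤ lam) :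
    #(Finset α) ≤ lam := by
  cases finite_or_infinite α
  · exact (Cardinal.mk_le_aleph0).trans hlam
  · rwa [Cardinal.mk_finset_of_infinite]

theorem mk_sigma_formula_le (L : FirstOrder.Language.{u, u}) :
    #(Σ n : ℕ, L.Formula (Unit ⊕ Fin n)) ≤ L.card + ℵ₀ := by
  have h : ∀ n : ℕ, #(L.Formula (Unit ⊕ Fin n)) ≤ L.card + ℵ₀ := fun n => by
    have h₁ : #(L.Formula (Unit ⊕ Fin n)) ≤ #(Σ k, L.BoundedFormula (Unit ⊕ Fin n) k) :=
      Cardinal.mk_le_of_injective (f := fun φ => ⟨0, φ⟩) fun φ ψ h => by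
        simpa using h
    refine h₁.trans (FirstOrder.Language.BoundedFormula.card_le.trans (max_le (by simp) ?_))
    rw [add_comm]
    refine add_le_add (by simp) ?_
    rw [Cardinal.lift_le_aleph0]
    exact Cardinal.mk_le_aleph0
  rw [Cardinal.mk_sigma]
  refine (Cardinal.sum_le_sum _ _ h).trans ?_
  rw [Cardinal.sum_const]
  simp only [Cardinal.mk_nat, Cardinal.lift_uzero, Cardinal.lift_aleph0]
  exact Cardinal.mul_le_of_le (by simp) (by simp) le_rfl

theorem mk_sigma_formula_prod_le (L : FirstOrder.Language.{u, u}) {A : Type u}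
    {lam : Cardinal.{u}} (hlam : ℵ₀ ≤ lam) (hL : L.card + ℵ₀ ≤ lam) (hA : #A ≤ lam) :
    #(Σ n : ℕ, L.Formula (Unit ⊕ Fin n) × (Fin n → A)) ≤ lam := by
  have h : #(Σ n : ℕ, L.Formula (Unit ⊕ Fin n) × (Fin n → A)) ≤
      #((Σ n : ℕ, L.Formula (Unit ⊕ Fin n)) × List A) := by
    refine Cardinal.mk_le_of_injective
      (f := fun q => (⟨q.1, q.2.1⟩, List.ofFn q.2.2)) ?_
    rintro ⟨n, φ, c⟩ ⟨m, ψ, d⟩ h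
    simp only [Prod.mk.injEq, Sigma.mk.injEq] at h
    obtain ⟨⟨rfl, h₁⟩, h₂⟩ := h
    obtain rfl := eq_of_heq h₁
    obtain rfl := List.ofFn_injective h₂
    rfl
  refine h.trans ?_
  rw [Cardinal.mk_prod, Cardinal.lift_id, Cardinal.lift_id]
  exact Cardinal.mul_le_of_le hlam ((mk_sigma_formula_le L).trans hL)
    ((Cardinal.mk_list_le_max A).trans (max_le hlam hA))

theorem IsCompleteTypeOn.not_mem_iff {α : Type v} {B : Set M}
    {p : Set (Σ n : ℕ, L.Formula (α ⊕ Fin n) × (Fin n → M))} (hp : IsCompleteTypeOn α B p)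
    {n : ℕ} (φ : L.Formula (α ⊕ Fin n)) {c : Fin n → M} (hc : ∀ i, c i ∈ B) :
    (⟨n, (φ.not, c)⟩ ∈ p) ↔ (⟨n, (φ, c)⟩ ∉ p) := by
  classical
  refine ⟨fun h h' => ?_, (hp.2.2 n φ c hc).resolve_left⟩
  obtain ⟨a, ha⟩ := hp.2.1 {⟨n, (φ, c)⟩, ⟨n, (φ.not, c)⟩} (by
    simp [Set.insert_subset_iff, h, h'])
  have h₁ := ha ⟨n, (φ, c)⟩ (by simp)
  have h₂ := ha ⟨n, (φ.not, c)⟩ (by simp)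
  exact FirstOrder.Language.Formula.realize_not.1 h₂ h₁

/-- If the theory (of the monster `M`) does not have the order property, then it is stable in
every infinite cardinal `lam` with `lam^{|T|} = lam`: over every parameter set of cardinality
`lam` there are at most `lam` complete 1-types. -/
theorem stmt18 (L : FirstOrder.Language.{u, u}) (M : Type u) [L.Structure M] [Infinite M]
    (hNOP : ¬ HasOrderProp L M)
    (lam : Cardinal.{u}) (hlam : ℵ₀ ≤ lam) (hpow : lam ^ (L.card + ℵ₀) = lam)
    (A : Set M) (hA : #A = lam) :
    #{p : Set (Σ n : ℕ, L.Formula (Unit ⊕ Fin n) × (Fin n → M)) //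
      IsCompleteTypeOn Unit A p} ≤ lam := by
  classical
  have hL : L.card + ℵ₀ ≤ lam := by
    refine (Cardinal.cantor _).le.trans ?_
    conv_rhs => rw [← hpow]
    exact Cardinal.power_le_power_right ((Cardinal.natCast_lt_aleph0 (n := 2)).le.trans hlam)
  let P := Σ n : ℕ, L.Formula (Unit ⊕ Fin n) × (Fin n → A)
  let K := Finset P
  have hK : #K ≤ lam := mk_finset_le hlam (mk_sigma_formula_prod_le L hlam hL hA.le)
  let v : ∀ n : ℕ, (Fin n → A) → Fin n → M := fun n c i => c i
  have hr : ∀ k : K, ∃ a : Unit → M, (∃ a : Unit → M, ∀ q ∈ k,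
      q.2.1.Realize (Sum.elim a (v _ q.2.2))) →
      ∀ q ∈ k, q.2.1.Realize (Sum.elim a (v _ q.2.2)) := by
    intro k
    by_cases h : ∃ a : Unit → M, ∀ q ∈ k, q.2.1.Realize (Sum.elim a (v _ q.2.2))
    · exact h.imp fun a ha _ => ha
    · exact ⟨fun _ => Classical.arbitrary M, fun h' => absurd h' h⟩
  choose r hr using hr
  let w : P → Σ n : ℕ, L.Formula (Unit ⊕ Fin n) × (Fin n → M) := fun q =>
    ⟨q.1, (q.2.1, v _ q.2.2)⟩
  let X := {p : Set (Σ n : ℕ, L.Formula (Unit ⊕ Fin n) × (Fin n → M)) //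
    IsCompleteTypeOn Unit A p}
  let F := Σ n : ℕ, L.Formula (Unit ⊕ Fin n)
  have key : ∀ (p : X) (f : F), ∃ s : Finset K, ∀ b c : Fin f.1 → A,
      (∀ x ∈ s, f.2.Realize (Sum.elim (r x) (v _ b)) ↔ f.2.Realize (Sum.elim (r x) (v _ c))) →
      ⟨f.1, (f.2, v _ b)⟩ ∈ p.1 → ⟨f.1, (f.2, v _ c)⟩ ∈ p.1 := by
    rintro ⟨p, hp⟩ ⟨n, φ⟩
    refine exists_finset_trace_determines hNOP φ r (v n)
      {b | (⟨n, (φ, v n b)⟩ : Σ n : ℕ, L.Formula (Unit ⊕ Fin n) × (Fin n → M)) ∈ p}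
      fun s t hs ht => ?_
    let k : Finset P := s.image (fun b => ⟨n, (φ, b)⟩) ∪ t.image (fun c => ⟨n, (φ.not, c)⟩)
    have hk := hr k (by
      obtain ⟨a, ha⟩ := hp.2.1 (k.image w) (by
        intro q hq
        obtain ⟨q', hq', rfl⟩ := Finset.mem_image.1 (Finset.mem_coe.1 hq)
        rcases Finset.mem_union.1 hq' with h | h <;>
          obtain ⟨b, hb, rfl⟩ := Finset.mem_image.1 h
        · exact hs b hb
        · exact (hp.not_mem_iff φ fun i => (b i).2).2 (ht b hb))
      exact ⟨a, fun q hq => ha _ (Finset.mem_image_of_mem _ hq)⟩)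
    refine ⟨k, fun b hb => ?_, fun c hc => ?_⟩
    · exact hk ⟨n, (φ, b)⟩ (Finset.mem_union_left _ (Finset.mem_image_of_mem _ hb))
    · exact FirstOrder.Language.Formula.realize_not.1
        (hk ⟨n, (φ.not, c)⟩ (Finset.mem_union_right _ (Finset.mem_image_of_mem _ hc)))
  choose s hs using key
  let tr : ∀ (f : F), Finset K → (Fin f.1 → A) → Finset K := fun f s b =>
    s.filter fun x => f.2.Realize (Sum.elim (r x) (v _ b))
  let D : X → F → Finset (Finset K) := fun p f => (s p f).powerset.filter fun t =>
    ∃ b : Fin f.1 → A, tr f (s p f) b = t ∧ ⟨f.1, (f.2, v _ b)⟩ ∈ p.1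
  have hD : ∀ p f (c : Fin f.1 → A), tr f (s p f) c ∈ D p f ↔ ⟨f.1, (f.2, v _ c)⟩ ∈ p.1 := by
    intro p f c
    simp only [D, Finset.mem_filter, Finset.mem_powerset]
    refine ⟨?_, fun h => ⟨Finset.filter_subset _ _, c, rfl, h⟩⟩
    rintro ⟨-, b, hb, hbp⟩
    refine hs p f b c (fun x hx => ?_) hbp
    have := Finset.ext_iff.1 hb x
    simpa [tr, hx] using this
  let code : X → F → Finset K × Finset (Finset K) := fun p f => (s p f, D p f)
  have hcode : Function.Injective code := by
    intro p q hpq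
    have hmem : ∀ (f : F) (c : Fin f.1 → A), (⟨f.1, (f.2, v _ c)⟩ ∈ p.1) ↔
        (⟨f.1, (f.2, v _ c)⟩ ∈ q.1) := by
      intro f c
      have h := congrFun hpq f
      simp only [code, Prod.mk.injEq] at h
      rw [← hD p f c, ← hD q f c, h.1, h.2]
    refine Subtype.ext (Set.ext ?_)
    rintro ⟨n, φ, c⟩
    exact ⟨fun h => (hmem ⟨n, φ⟩ fun i => ⟨c i, p.2.1 _ h i⟩).1 h,
      fun h => (hmem ⟨n, φ⟩ fun i => ⟨c i, q.2.1 _ h i⟩).2 h⟩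
  have hS : #(Finset K) ≤ lam := mk_finset_le hlam hK
  have hC : #(Finset K × Finset (Finset K)) ≤ lam := by
    rw [Cardinal.mk_prod, Cardinal.lift_id, Cardinal.lift_id]
    exact Cardinal.mul_le_of_le hlam hS (mk_finset_le hlam hS)
  calc #X ≤ #(F → Finset K × Finset (Finset K)) := Cardinal.mk_le_of_injective hcode
    _ = #(Finset K × Finset (Finset K)) ^ #F := by
      rw [Cardinal.mk_arrow, Cardinal.lift_id, Cardinal.lift_id]
    _ ≤ lam ^ #F := Cardinal.power_le_power_right hC
    _ ≤ lam ^ (L.card + ℵ₀) := Cardinal.power_le_power_left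
      (Cardinal.aleph0_pos.trans_le hlam).ne' (mk_sigma_formula_le L)
    _ = lam := hpow
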